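/- A smallest counterexample contains no cycle of length 6. -/

import Mathlib

open SimpleGraph

/-- The degree of a vertex, as the cardinality of its neighbor set. -/
noncomputable def deg {V : Type} (G : SimpleGraph V) (v : V) : ℕ :=
  (G.neighborSet v).ncard

/-- The potential of a finite graph: `5 n(G) - 4 e(G)`. -/
noncomputable def pot {V : Type} [Fintype V] (G : SimpleGraph V) : ℤ :=
  5 * (Fintype.card V : ℤ) - 4 * (G.edgeSet.ncard : ℤ)

/-- A graph is 5/2-critical if it has no homomorphism to the 5-cycle
but every proper subgraph has one. -/
def Critical52 {V : Type} (G : SimpleGraph V) : Prop :=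
  IsEmpty (G →g cycleGraph 5) ∧
  ∀ H : G.Subgraph, H ≠ ⊤ → Nonempty (H.coe →g cycleGraph 5)

/-- The exceptional graph `E₁`: a 9-cycle `0 1 2 3 4 5 6 7 8` together
with a vertex `9` adjacent to `0`, `3` and `6`. -/
def E1 : SimpleGraph (Fin 10) := SimpleGraph.fromEdgeSet
  {s(0,1), s(1,2), s(2,3), s(3,4), s(4,5), s(5,6), s(6,7), s(7,8), s(8,0),
   s(9,0), s(9,3), s(9,6)}

/-- The exceptional graph `E₂`: two 5-cycles `0 1 2 3 4` and `0 1 5 6 7`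
sharing exactly the edge `01`, together with a path `3 8 9 6`. -/
def E2 : SimpleGraph (Fin 10) := SimpleGraph.fromEdgeSet
  {s(0,1), s(1,2), s(2,3), s(3,4), s(4,0),
   s(1,5), s(5,6), s(6,7), s(7,0),
   s(3,8), s(8,9), s(9,6)}

/-- A smallest counterexample: a 5/2-critical graph, not isomorphic to `C₃`, `E₁`, `E₂`,
with potential at least 2, such that every smaller 5/2-critical graph not isomorphic
to `C₃`, `E₁`, `E₂` has potential at most 1. -/
def SmallestCex {V : Type} [Fintype V] (G : SimpleGraph V) : Prop :=
  Critical52 G ∧ IsEmpty (G ≃g cycleGraph 3) ∧ IsEmpty (G ≃g E1) ∧ IsEmpty (G ≃g E2) ∧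
  2 ≤ pot G ∧
  ∀ (m : ℕ) (H : SimpleGraph (Fin m)), Critical52 H →
    IsEmpty (H ≃g cycleGraph 3) → IsEmpty (H ≃g E1) → IsEmpty (H ≃g E2) →
    m < Fintype.card V → pot H ≤ 1

/-- A string: a path of positive length whose endvertices have degree at least 3
and whose internal vertices have degree 2. A `k`-string is a string of length `k+1`. -/
def IsString {V : Type} (G : SimpleGraph V) {u v : V} (p : G.Walk u v) : Prop :=
  p.IsPath ∧ 0 < p.length ∧ 3 ≤ deg G u ∧ 3 ≤ deg G v ∧
  ∀ w ∈ p.support, w ≠ u → w ≠ v → deg G w = 2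

/-- `v` lies on a 5-cycle of `G`. -/
def InFiveCycle {V : Type} (G : SimpleGraph V) (v : V) : Prop :=
  ∃ (w : V) (c : G.Walk w w), c.IsCycle ∧ c.length = 5 ∧ v ∈ c.support

/-- `v` is a `(k₁,k₂,k₃)`-vertex: it has degree 3 and is the end of a `k₁`-string,
a `k₂`-string and a `k₃`-string leaving `v` through its three distinct edges. -/
def IsVertex3 {V : Type} (G : SimpleGraph V) (v : V) (k1 k2 k3 : ℕ) : Prop :=
  deg G v = 3 ∧ ∃ (u1 u2 u3 : V) (p1 : G.Walk v u1) (p2 : G.Walk v u2) (p3 : G.Walk v u3),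
    IsString G p1 ∧ IsString G p2 ∧ IsString G p3 ∧
    p1.getVert 1 ≠ p2.getVert 1 ∧ p1.getVert 1 ≠ p3.getVert 1 ∧ p2.getVert 1 ≠ p3.getVert 1 ∧
    p1.length = k1 + 1 ∧ p2.length = k2 + 1 ∧ p3.length = k3 + 1

/-- `v` is a `(k₁,k₂,k₃,k₄)`-vertex: it has degree 4 and is the end of strings of the
corresponding lengths leaving `v` through its four distinct edges. -/
def IsVertex4 {V : Type} (G : SimpleGraph V) (v : V) (k1 k2 k3 k4 : ℕ) : Prop :=
  deg G v = 4 ∧ ∃ (u1 u2 u3 u4 : V) (p1 : G.Walk v u1) (p2 : G.Walk v u2)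
    (p3 : G.Walk v u3) (p4 : G.Walk v u4),
    IsString G p1 ∧ IsString G p2 ∧ IsString G p3 ∧ IsString G p4 ∧
    p1.getVert 1 ≠ p2.getVert 1 ∧ p1.getVert 1 ≠ p3.getVert 1 ∧ p1.getVert 1 ≠ p4.getVert 1 ∧
    p2.getVert 1 ≠ p3.getVert 1 ∧ p2.getVert 1 ≠ p4.getVert 1 ∧ p3.getVert 1 ≠ p4.getVert 1 ∧
    p1.length = k1 + 1 ∧ p2.length = k2 + 1 ∧ p3.length = k3 + 1 ∧ p4.length = k4 + 1

/-- `H` contains at least two distinct cycles, where cycles are counted as subgraphs,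
i.e. two cycles are distinct if their edge sets differ. -/
def TwoDistinctCycles {V : Type} (H : SimpleGraph V) : Prop :=
  ∃ (v1 v2 : V) (c1 : H.Walk v1 v1) (c2 : H.Walk v2 v2),
    c1.IsCycle ∧ c2.IsCycle ∧ {e | e ∈ c1.edges} ≠ {e | e ∈ c2.edges}

/-- The degree of a 5-cycle (cell) `c` in `G`: the number of strings not contained in `c`
that intersect `c`, strings being counted by their edge sets. -/
noncomputable def cellDegree {V : Type} (G : SimpleGraph V) {w : V} (c : G.Walk w w) : ℕ :=
  {S : Set (Sym2 V) | ∃ (u v : V) (p : G.Walk u v), IsString G p ∧ S = {e | e ∈ p.edges} ∧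
    ¬ S ⊆ {e | e ∈ c.edges} ∧ ∃ x ∈ p.support, x ∈ c.support}.ncard


/-- Number of ordered adjacent pairs inside `S`. -/
noncomputable def dpairs {V : Type} (G : SimpleGraph V) (S : Set V) : ℕ :=
  {p : V × V | p.1 ∈ S ∧ p.2 ∈ S ∧ G.Adj p.1 p.2}.ncard

lemma dpairs_univ {V : Type} [Fintype V] (G : SimpleGraph V) :
    dpairs G Set.univ = 2 * G.edgeSet.ncard := by
  classical
  have h1 : G.edgeSet.ncard = G.edgeFinset.card := by
    rw [Set.ncard_eq_toFinset_card', Set.toFinset_card, ← SimpleGraph.edgeFinset_card]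
  rw [h1, ← G.dart_card_eq_twice_card_edges]
  unfold dpairs
  have h2 : {p : V × V | p.1 ∈ Set.univ ∧ p.2 ∈ Set.univ ∧ G.Adj p.1 p.2}
      = Set.range (SimpleGraph.Dart.toProd (G := G)) := by
    ext p
    simp only [Set.mem_univ, true_and, Set.mem_ofPred_eq, Set.mem_range]
    constructor
    · intro h
      exact ⟨⟨p, h⟩, rfl⟩
    · rintro ⟨d, rfl⟩
      exact d.adj
  rw [h2, ← Set.image_univ, Set.ncard_image_of_injective _ SimpleGraph.Dart.toProd_injective,
    Set.ncard_univ, Nat.card_eq_fintype_card]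

lemma pot_eq {V : Type} [Fintype V] (G : SimpleGraph V) :
    pot G = 5 * (Fintype.card V : ℤ) - 2 * (dpairs G Set.univ : ℤ) := by
  rw [dpairs_univ]; unfold pot; push_cast; ring

/-- A coloring of a critical graph off a proper vertex subset. -/
lemma crit_color {V : Type} {G : SimpleGraph V} (hG : Critical52 G) (S : Set V)
    (hS : S ≠ Set.univ) :
    ∃ f : V → Fin 5, ∀ u ∈ S, ∀ v ∈ S, G.Adj u v → (cycleGraph 5).Adj (f u) (f v) := by
  classical
  have hne : (⊤ : G.Subgraph).induce S ≠ ⊤ := by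
    intro h
    apply hS
    have := congrArg SimpleGraph.Subgraph.verts h
    simpa using this
  obtain ⟨φ⟩ := hG.2 _ hne
  refine ⟨fun v => if h : v ∈ S then φ ⟨v, h⟩ else 0, ?_⟩
  intro u hu v hv huv
  simp only [hu, hv, dif_pos]
  apply φ.map_adj
  simp [hu, hv, huv]

lemma not_color {V : Type} {G : SimpleGraph V} (hG : Critical52 G) (f : V → Fin 5)
    (hf : ∀ u v, G.Adj u v → (cycleGraph 5).Adj (f u) (f v)) : False :=
  hG.1.false ⟨f, fun {a b} h => hf a b h⟩

lemma exists_crit {V : Type} [Finite V] (G : SimpleGraph V) (h : IsEmpty (G →g cycleGraph 5)) :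
    ∃ (m : ℕ) (H : SimpleGraph (Fin m)) (g : Fin m → V), Function.Injective g ∧
      (∀ i j, H.Adj i j → G.Adj (g i) (g j)) ∧ Critical52 H := by
  classical
  let P : ℕ → Prop := fun k => ∃ (m : ℕ) (H : SimpleGraph (Fin m)) (g : Fin m → V),
    Function.Injective g ∧ (∀ i j, H.Adj i j → G.Adj (g i) (g j)) ∧
    IsEmpty (H →g cycleGraph 5) ∧ m + dpairs H Set.univ = k
  have hP : ∃ k, P k := by
    have := Fintype.ofFinite V
    let e := Fintype.equivFin V
    refine ⟨_, Fintype.card V, G.comap e.symm, e.symm, e.symm.injective, fun i j h => h, ?_, rfl⟩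
    constructor
    intro φ
    refine h.false ⟨fun v => φ (e v), fun {a b} hab => φ.map_adj ?_⟩
    simpa using hab
  obtain ⟨m, H, g, hg, hgh, hH, hk⟩ := Nat.find_spec hP
  refine ⟨m, H, g, hg, hgh, hH, ?_⟩
  intro S hS
  by_contra hcon
  rw [not_nonempty_iff] at hcon
  let e := Fintype.equivFin S.verts
  let H2 : SimpleGraph (Fin (Fintype.card S.verts)) := S.coe.comap e.symm
  have hd : dpairs H2 Set.univ = {p : Fin m × Fin m | S.Adj p.1 p.2}.ncard := by
    unfold dpairs
    have : {p : Fin m × Fin m | S.Adj p.1 p.2} = (fun p : Fin (Fintype.card S.verts) ×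
        Fin (Fintype.card S.verts) => ((e.symm p.1 : Fin m), (e.symm p.2 : Fin m))) ''
        {p | p.1 ∈ Set.univ ∧ p.2 ∈ Set.univ ∧ H2.Adj p.1 p.2} := by
      ext ⟨a, b⟩
      simp only [Set.mem_ofPred_eq, Set.mem_image, Set.mem_univ, true_and, Prod.exists,
        Prod.mk.injEq]
      constructor
      · intro hab
        refine ⟨e ⟨a, S.edge_vert hab⟩, e ⟨b, S.edge_vert hab.symm⟩, ?_, by simp, by simp⟩
        simpa [H2] using hab
      · rintro ⟨i, j, hij, rfl, rfl⟩
        exact hij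
    rw [this, Set.ncard_image_of_injective]
    rintro ⟨a, b⟩ ⟨c, d⟩ hh
    simp only [Prod.mk.injEq] at hh
    have h1 := e.symm.injective (Subtype.ext hh.1)
    have h2 := e.symm.injective (Subtype.ext hh.2)
    rw [h1, h2]
  have hsub : {p : Fin m × Fin m | S.Adj p.1 p.2} ⊆
      {p : Fin m × Fin m | p.1 ∈ Set.univ ∧ p.2 ∈ Set.univ ∧ H.Adj p.1 p.2} := by
    intro p hp
    exact ⟨trivial, trivial, S.adj_sub hp⟩
  have hle := Set.ncard_le_ncard hsub
  have hcard : Fintype.card S.verts ≤ m := by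
    simpa using Fintype.card_subtype_le (fun x => x ∈ S.verts)
  have hmin : Nat.find hP ≤ Fintype.card S.verts + dpairs H2 Set.univ := by
    apply Nat.find_min' hP
    refine ⟨_, H2, fun i => g (e.symm i), ?_, ?_, ?_, rfl⟩
    · intro i j hij
      exact e.symm.injective (Subtype.ext (hg hij))
    · intro i j hij
      exact hgh _ _ (S.adj_sub hij)
    · constructor
      intro φ
      refine hcon.false ⟨fun v => φ (e v), fun {a b} hab => φ.map_adj ?_⟩
      simpa [H2] using hab
  rw [← hk, hd] at hmin
  have hd2 : dpairs H Set.univ = {p : Fin m × Fin m | p.1 ∈ Set.univ ∧ p.2 ∈ Set.univ ∧ H.Adj p.1 p.2}.ncard := rfl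
  have e1 : Fintype.card S.verts = m := by omega
  have e2 := Set.eq_of_subset_of_ncard_le hsub (by omega)
  apply hS
  have hv : S.verts = Set.univ := by
    rw [← Set.toFinset_eq_univ, ← Finset.card_eq_iff_eq_univ, Set.toFinset_card, e1]; simp
  ext a b
  · simp [hv]
  · have : (a, b) ∈ {p : Fin m × Fin m | S.Adj p.1 p.2} ↔ (a, b) ∈
      {p : Fin m × Fin m | p.1 ∈ Set.univ ∧ p.2 ∈ Set.univ ∧ H.Adj p.1 p.2} := by rw [e2]
    simpa using this

lemma pot_iso {V W : Type} [Fintype V] [Fintype W] {G : SimpleGraph V} {H : SimpleGraph W}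
    (e : G ≃g H) : pot G = pot H := by
  classical
  unfold pot
  rw [Fintype.card_congr e.toEquiv, ← Nat.card_coe_set_eq, ← Nat.card_coe_set_eq,
    Nat.card_congr e.mapEdgeSet]

lemma pot_E1 : pot E1 ≤ 2 := by
  have h : 24 ≤ dpairs E1 Set.univ := by
    have hs : (↑({(0,1),(1,2),(2,3),(3,4),(4,5),(5,6),(6,7),(7,8),(8,0),(9,0),(9,3),(9,6),
      (1,0),(2,1),(3,2),(4,3),(5,4),(6,5),(7,6),(8,7),(0,8),(0,9),(3,9),(6,9)} :
      Finset (Fin 10 × Fin 10)) : Set (Fin 10 × Fin 10)) ⊆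
      {p | p.1 ∈ Set.univ ∧ p.2 ∈ Set.univ ∧ E1.Adj p.1 p.2} := by
      intro p hp
      simp only [Finset.coe_insert, Finset.coe_singleton, Set.mem_insert_iff,
        Set.mem_singleton_iff] at hp
      refine ⟨trivial, trivial, ?_⟩
      unfold E1
      rcases hp with h|h|h|h|h|h|h|h|h|h|h|h|h|h|h|h|h|h|h|h|h|h|h|h <;> subst h <;> simp
    have := Set.ncard_le_ncard hs
    rw [Set.ncard_coe_finset] at this
    exact this
  rw [pot_eq]; simp; omega

lemma pot_E2 : pot E2 ≤ 2 := by
  have h : 24 ≤ dpairs E2 Set.univ := by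
    have hs : (↑({(0,1),(1,2),(2,3),(3,4),(4,0),(1,5),(5,6),(6,7),(7,0),(3,8),(8,9),(9,6),
      (1,0),(2,1),(3,2),(4,3),(0,4),(5,1),(6,5),(7,6),(0,7),(8,3),(9,8),(6,9)} :
      Finset (Fin 10 × Fin 10)) : Set (Fin 10 × Fin 10)) ⊆
      {p | p.1 ∈ Set.univ ∧ p.2 ∈ Set.univ ∧ E2.Adj p.1 p.2} := by
      intro p hp
      simp only [Finset.coe_insert, Finset.coe_singleton, Set.mem_insert_iff,
        Set.mem_singleton_iff] at hp
      refine ⟨trivial, trivial, ?_⟩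
      unfold E2
      rcases hp with h|h|h|h|h|h|h|h|h|h|h|h|h|h|h|h|h|h|h|h|h|h|h|h <;> subst h <;> simp
    have := Set.ncard_le_ncard hs
    rw [Set.ncard_coe_finset] at this
    exact this
  rw [pot_eq]; simp; omega

lemma cyc3_adj : ∀ i j : Fin 3, i ≠ j → (cycleGraph 3).Adj i j := by decide

lemma pot_C3 : pot (cycleGraph 3) ≤ 3 := by
  have h : 6 ≤ dpairs (cycleGraph 3) Set.univ := by
    have hs : (↑({(0,1),(1,2),(2,0),(1,0),(2,1),(0,2)} :
      Finset (Fin 3 × Fin 3)) : Set (Fin 3 × Fin 3)) ⊆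
      {p | p.1 ∈ Set.univ ∧ p.2 ∈ Set.univ ∧ (cycleGraph 3).Adj p.1 p.2} := by
      intro p hp
      simp only [Finset.coe_insert, Finset.coe_singleton, Set.mem_insert_iff,
        Set.mem_singleton_iff] at hp
      refine ⟨trivial, trivial, cyc3_adj _ _ ?_⟩
      rcases hp with h|h|h|h|h|h <;> subst h <;> decide
    have := Set.ncard_le_ncard hs
    rw [Set.ncard_coe_finset] at this
    exact this
  rw [pot_eq]; simp; omega

lemma small_pot {V : Type} [Fintype V] {G : SimpleGraph V} (hG : SmallestCex G) {m : ℕ}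
    (H : SimpleGraph (Fin m)) (hH : Critical52 H) (hm : m < Fintype.card V) :
    5 * (m : ℤ) - 2 * (dpairs H Set.univ : ℤ) ≤ 2 ∨
    (5 * (m : ℤ) - 2 * (dpairs H Set.univ : ℤ) ≤ 3 ∧ m = 3 ∧ ∀ i j, i ≠ j → H.Adj i j) := by
  have hp := pot_eq H
  rw [Fintype.card_fin] at hp
  rw [← hp]
  by_cases h3 : IsEmpty (H ≃g cycleGraph 3)
  · left
    by_cases h1 : IsEmpty (H ≃g E1)
    · by_cases h2 : IsEmpty (H ≃g E2)
      · have := hG.2.2.2.2.2 m H hH h3 h1 h2 hm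
        omega
      · rw [not_isEmpty_iff] at h2
        rw [pot_iso h2.some]; exact pot_E2
    · rw [not_isEmpty_iff] at h1
      rw [pot_iso h1.some]; exact pot_E1
  · right
    rw [not_isEmpty_iff] at h3
    obtain ⟨e⟩ := h3
    refine ⟨?_, ?_, ?_⟩
    · rw [pot_iso e]; exact pot_C3
    · simpa using Fintype.card_congr e.toEquiv
    · intro i j hij
      exact e.map_adj_iff.1 (cyc3_adj _ _ (fun h => hij (e.injective h)))

lemma triangle_free {V : Type} [Fintype V] {G : SimpleGraph V} (hG : SmallestCex G) (a b c : V)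
    (hab : G.Adj a b) (hbc : G.Adj b c) (hac : G.Adj a c) : False := by
  classical
  by_cases hS : ({a, b, c} : Set V) = Set.univ
  · have hall : ∀ x : V, x = a ∨ x = b ∨ x = c := by
      intro x
      have : x ∈ ({a, b, c} : Set V) := by rw [hS]; trivial
      simpa using this
    have hcard : Fintype.card V = 3 := by
      have : (Finset.univ : Finset V) = {a, b, c} := by
        ext x; simp [hall x]
      rw [← Finset.card_univ, this, Finset.card_eq_three]
      exact ⟨a, b, c, hab.ne, hac.ne, hbc.ne, rfl⟩
    let e : V ≃ Fin 3 := Fintype.equivFinOfCardEq hcard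
    refine hG.2.1.false ⟨e, ?_⟩
    intro x y
    constructor
    · intro h
      have hne : x ≠ y := fun h' => h.ne (by rw [h'])
      rcases hall x with rfl | rfl | rfl <;> rcases hall y with rfl | rfl | rfl <;>
        first | exact absurd rfl hne | assumption | (apply SimpleGraph.Adj.symm; assumption)
    · intro h
      exact cyc3_adj _ _ (fun h' => h.ne (e.injective h'))
  · obtain ⟨f, hf⟩ := crit_color hG.1 _ hS
    have h1 := hf a (by simp) b (by simp) hab
    have h2 := hf b (by simp) c (by simp) hbc
    have h3 := hf a (by simp) c (by simp) hac
    have key : ∀ x y z : Fin 5, (cycleGraph 5).Adj x y → (cycleGraph 5).Adj y z →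
      (cycleGraph 5).Adj x z → False := by decide
    exact key _ _ _ h1 h2 h3

/-- Adjacency in the graph obtained from `G` by replacing `R` with `T` along `f`. -/
def QAdj {V τ : Type} (G : SimpleGraph V) (T : SimpleGraph τ) (R : Set V) (f : V → τ) :
    V ⊕ τ → V ⊕ τ → Prop
  | Sum.inl u, Sum.inl v => G.Adj u v
  | Sum.inl u, Sum.inr t => ∃ r ∈ R, f r = t ∧ G.Adj u r
  | Sum.inr t, Sum.inl v => ∃ r ∈ R, f r = t ∧ G.Adj r v
  | Sum.inr s, Sum.inr t => T.Adj s t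

/-- Pairs of `G` not inside `R` that are used by the critical subgraph. -/
def usedPairs {V τ : Type} (G : SimpleGraph V) (R : Set V) (f : V → τ)
    (A : Set V) (Y : Set τ) : Set (V × V) :=
  {p | G.Adj p.1 p.2 ∧ ¬ (p.1 ∈ R ∧ p.2 ∈ R) ∧ (p.1 ∈ A ∨ (p.1 ∈ R ∧ f p.1 ∈ Y)) ∧
    (p.2 ∈ A ∨ (p.2 ∈ R ∧ f p.2 ∈ Y))}

/-- The critical graph `H` found in the folded graph. -/
structure FoldData {V τ : Type} (G : SimpleGraph V) (T : SimpleGraph τ) (R : Set V)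
    (f : V → τ) (m : ℕ) (H : SimpleGraph (Fin m)) (g : Fin m → V ⊕ τ) (A : Set V) (Y : Set τ) :
    Prop where
  crit : Critical52 H
  inj : Function.Injective g
  adj : ∀ i j, H.Adj i j → QAdj G T R f (g i) (g j)
  memA : ∀ u, u ∈ A ↔ ∃ i, g i = Sum.inl u
  memY : ∀ t, t ∈ Y ↔ ∃ i, g i = Sum.inr t
  disj : ∀ u ∈ A, u ∉ R
  card : m = A.ncard + Y.ncard
  count : dpairs H Set.univ ≤ dpairs T Y + (usedPairs G R f A Y).ncard

lemma fold_exists {V τ : Type} [Fintype V] [Fintype τ] {G : SimpleGraph V} (hG : Critical52 G)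
    (T : SimpleGraph τ) (R : Set V) (f : V → τ)
    (hf : ∀ u ∈ R, ∀ v ∈ R, G.Adj u v → T.Adj (f u) (f v)) (hc : Fintype.card τ < R.ncard) :
    ∃ (m : ℕ) (H : SimpleGraph (Fin m)) (g : Fin m → V ⊕ τ) (A : Set V) (Y : Set τ),
      FoldData G T R f m H g A Y ∧ m < Fintype.card V := by
  classical
  let emb : {v // v ∉ R} ⊕ τ → V ⊕ τ := Sum.map Subtype.val id
  have hemb : Function.Injective emb :=
    Sum.map_injective.2 ⟨Subtype.val_injective, Function.injective_id⟩
  let G' : SimpleGraph ({v // v ∉ R} ⊕ τ) :=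
    { Adj := fun x y => QAdj G T R f (emb x) (emb y)
      symm := ⟨by
        rintro (x | x) (y | y) h
        · exact G.adj_symm h
        · obtain ⟨r, h1, h2, h3⟩ := h
          exact ⟨r, h1, h2, h3.symm⟩
        · obtain ⟨r, h1, h2, h3⟩ := h
          exact ⟨r, h1, h2, h3.symm⟩
        · exact T.adj_symm h⟩
      loopless := ⟨by
        rintro (x | x) h
        · exact G.irrefl h
        · exact T.irrefl h⟩ }
  have hG' : IsEmpty (G' →g cycleGraph 5) := by
    constructor
    intro φ
    refine not_color hG (fun v => if h : v ∈ R then φ (Sum.inr (f v)) else φ (Sum.inl ⟨v, h⟩)) ?_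
    intro u v huv
    by_cases hu : u ∈ R <;> by_cases hv : v ∈ R <;> simp only [hu, hv, dif_pos, dif_neg, not_false_eq_true] <;>
      apply φ.map_adj
    · exact hf u hu v hv huv
    · exact ⟨u, hu, rfl, huv⟩
    · exact ⟨v, hv, rfl, huv⟩
    · exact huv
  obtain ⟨m, H, g₀, hg, hgh, hH⟩ := exists_crit G' hG'
  let g := fun i => emb (g₀ i)
  have hginj : Function.Injective g := hemb.comp hg
  have hgR : ∀ i u, g i = Sum.inl u → u ∉ R := by
    intro i u h
    simp only [g, emb] at h
    rcases hh : g₀ i with x | x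
    · rw [hh] at h
      simp at h
      rw [← h]; exact x.2
    · rw [hh] at h
      simp at h
  let A : Set V := {u | ∃ i, g i = Sum.inl u}
  let Y : Set τ := {t | ∃ i, g i = Sum.inr t}
  have hcard : m = A.ncard + Y.ncard := by
    have h1 : Set.range g = Sum.inl '' A ∪ Sum.inr '' Y := by
      ext x
      rcases x with x | x <;> simp [A, Y]
    have h2 : (Set.range g).ncard = m := by
      rw [← Set.image_univ, Set.ncard_image_of_injective _ hginj, Set.ncard_univ]; simp
    rw [← h2, h1, Set.ncard_union_eq, Set.ncard_image_of_injective _ Sum.inl_injective,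
      Set.ncard_image_of_injective _ Sum.inr_injective]
    rw [Set.disjoint_left]
    rintro _ ⟨a, _, rfl⟩ ⟨b, _, h⟩
    simp at h
  have hdisj : ∀ u ∈ A, u ∉ R := by
    rintro u ⟨i, hi⟩
    exact hgR i u hi
  refine ⟨m, H, g, A, Y, ⟨hH, hginj, fun i j h => hgh i j h, fun u => Iff.rfl, fun u => Iff.rfl,
    hdisj, hcard, ?_⟩, ?_⟩
  · let q : V → V ⊕ τ := fun v => if v ∈ R then Sum.inr (f v) else Sum.inl v
    have hsub : (fun p : Fin m × Fin m => (g p.1, g p.2)) ''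
        {p | p.1 ∈ Set.univ ∧ p.2 ∈ Set.univ ∧ H.Adj p.1 p.2} ⊆
        (fun p : τ × τ => ((Sum.inr p.1 : V ⊕ τ), (Sum.inr p.2 : V ⊕ τ))) ''
          {p | p.1 ∈ Y ∧ p.2 ∈ Y ∧ T.Adj p.1 p.2} ∪
        (fun p : V × V => (q p.1, q p.2)) '' usedPairs G R f A Y := by
      rintro _ ⟨⟨i, j⟩, ⟨-, -, hij⟩, rfl⟩
      have hQ : QAdj G T R f (g i) (g j) := hgh i j hij
      simp only at hij ⊢
      rcases hi : g i with u | s <;> rcases hj : g j with v | t <;> rw [hi, hj] at hQ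
      · right
        have hu := hgR i u hi
        have hv := hgR j v hj
        refine ⟨(u, v), ⟨hQ, fun h => hu h.1, Or.inl ⟨i, hi⟩, Or.inl ⟨j, hj⟩⟩, ?_⟩
        simp [q, hu, hv]
      · right
        have hu := hgR i u hi
        obtain ⟨r, hr, rfl, hur⟩ := hQ
        refine ⟨(u, r), ⟨hur, fun h => hu h.1, Or.inl ⟨i, hi⟩, Or.inr ⟨hr, ⟨j, hj⟩⟩⟩, ?_⟩
        simp [q, hu, hr]
      · right
        have hv := hgR j v hj
        obtain ⟨r, hr, rfl, hur⟩ := hQ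
        refine ⟨(r, v), ⟨hur, fun h => hv h.2, Or.inr ⟨hr, ⟨i, hi⟩⟩, Or.inl ⟨j, hj⟩⟩, ?_⟩
        simp [q, hv, hr]
      · left
        exact ⟨(s, t), ⟨⟨i, hi⟩, ⟨j, hj⟩, hQ⟩, rfl⟩
    have h1 : dpairs H Set.univ = ((fun p : Fin m × Fin m => (g p.1, g p.2)) ''
        {p | p.1 ∈ Set.univ ∧ p.2 ∈ Set.univ ∧ H.Adj p.1 p.2}).ncard := by
      rw [Set.ncard_image_of_injective]
      · rfl
      · rintro ⟨a, b⟩ ⟨c, d⟩ h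
        simp only [Prod.mk.injEq] at h
        rw [hginj h.1, hginj h.2]
    rw [h1]
    refine (Set.ncard_le_ncard hsub).trans ((Set.ncard_union_le _ _).trans ?_)
    exact Nat.add_le_add (Set.ncard_image_le (Set.toFinite _)) (Set.ncard_image_le (Set.toFinite _))
  · have h1 : A.ncard ≤ Rᶜ.ncard := Set.ncard_le_ncard hdisj
    have h2 : Y.ncard ≤ Fintype.card τ := by
      rw [← Nat.card_eq_fintype_card, ← Set.ncard_univ]
      exact Set.ncard_le_ncard (Set.subset_univ _)
    have h3 := Set.ncard_add_ncard_compl R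
    rw [Nat.card_eq_fintype_card] at h3
    omega

/-- Adding the used pairs to those inside `R`. -/
lemma dpairs_union {V τ : Type} [Fintype V] (G : SimpleGraph V) (R : Set V) (f : V → τ)
    (A : Set V) (Y : Set τ) :
    dpairs G R + (usedPairs G R f A Y).ncard ≤ dpairs G (R ∪ A) := by
  unfold dpairs
  rw [← Set.ncard_union_eq]
  · refine Set.ncard_le_ncard ?_ (Set.toFinite _)
    rintro p (⟨h1, h2, h3⟩ | ⟨h1, h2, h3, h4⟩)
    · exact ⟨Or.inl h1, Or.inl h2, h3⟩
    · refine ⟨?_, ?_, h1⟩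
      · rcases h3 with h | h
        · exact Or.inr h
        · exact Or.inl h.1
      · rcases h4 with h | h
        · exact Or.inr h
        · exact Or.inl h.1
  · rw [Set.disjoint_left]
    rintro p ⟨h1, h2, h3⟩ ⟨_, h4, _⟩
    exact h4 ⟨h1, h2⟩

lemma fold_A_nonempty {V τ : Type} {G : SimpleGraph V} {T : SimpleGraph τ} {R : Set V}
    {f : V → τ} {m : ℕ} {H : SimpleGraph (Fin m)} {g : Fin m → V ⊕ τ} {A : Set V} {Y : Set τ}
    (F : FoldData G T R f m H g A Y) (k : τ → Fin 5)
    (hk : ∀ s t, T.Adj s t → (cycleGraph 5).Adj (k s) (k t)) : A.Nonempty := by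
  by_contra hA
  rw [Set.not_nonempty_iff_eq_empty] at hA
  have hn : ∀ i u, g i ≠ Sum.inl u := by
    intro i u h
    have : u ∈ A := (F.memA u).2 ⟨i, h⟩
    rw [hA] at this
    exact this
  refine not_color F.crit (fun i => Sum.elim (fun _ => 0) k (g i)) ?_
  intro i j hij
  have hQ := F.adj i j hij
  rcases hi : g i with u | s
  · exact absurd hi (hn _ _)
  · rcases hj : g j with v | t
    · exact absurd hj (hn _ _)
    · rw [hi, hj] at hQ
      exact hk s t hQ

/-- If the used part of `T` lifts back to `G`, avoiding some vertex, contradiction. -/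
lemma fold_no_lift {V τ : Type} {G : SimpleGraph V} (hG : Critical52 G)
    {T : SimpleGraph τ} {R : Set V}
    {f : V → τ} {m : ℕ} {H : SimpleGraph (Fin m)} {g : Fin m → V ⊕ τ} {A : Set V} {Y : Set τ}
    (F : FoldData G T R f m H g A Y) (k : τ → V) (w : V) (hw : w ∈ R)
    (hk0 : ∀ s ∈ Y, k s ≠ w)
    (hk1 : ∀ s ∈ Y, ∀ r ∈ R, f r = s → r = k s)
    (hk2 : ∀ s ∈ Y, ∀ t ∈ Y, T.Adj s t → G.Adj (k s) (k t)) : False := by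
  obtain ⟨c, hc⟩ := crit_color hG {v | v ≠ w} (by
    intro h
    have : w ∈ {v | v ≠ w} := by rw [h]; trivial
    exact this rfl)
  refine not_color F.crit (fun i => c (Sum.elim id k (g i))) ?_
  intro i j hij
  have hQ := F.adj i j hij
  have hne : ∀ i, Sum.elim id k (g i) ≠ w := by
    intro i
    rcases hi : g i with u | s
    · intro h
      simp at h
      subst h
      exact F.disj u ((F.memA u).2 ⟨i, hi⟩) hw
    · exact hk0 s ((F.memY s).2 ⟨i, hi⟩)
  refine hc _ (hne i) _ (hne j) ?_
  rcases hi : g i with u | s <;> rcases hj : g j with v | t <;> rw [hi, hj] at hQ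
  · exact hQ
  · obtain ⟨r, hr, h1, h2⟩ := hQ
    rw [hk1 t ((F.memY t).2 ⟨j, hj⟩) r hr h1] at h2
    exact h2
  · obtain ⟨r, hr, h1, h2⟩ := hQ
    rw [hk1 s ((F.memY s).2 ⟨i, hi⟩) r hr h1] at h2
    exact h2
  · exact hk2 s ((F.memY s).2 ⟨i, hi⟩) t ((F.memY t).2 ⟨j, hj⟩) hQ

/-- When the critical subgraph is a triangle meeting `T` in one vertex we find an ear. -/
lemma fold_ear {V τ : Type} {G : SimpleGraph V} {T : SimpleGraph τ} {R : Set V}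
    {f : V → τ} {m : ℕ} {H : SimpleGraph (Fin m)} {g : Fin m → V ⊕ τ} {A : Set V} {Y : Set τ}
    (F : FoldData G T R f m H g A Y) (hm : m = 3) (hH : ∀ i j, i ≠ j → H.Adj i j)
    (hY : Y.ncard = 1) :
    ∃ x y s t, A = {x, y} ∧ x ≠ y ∧ G.Adj x y ∧ s ∈ R ∧ t ∈ R ∧ G.Adj x s ∧ G.Adj y t ∧
      f s ∈ Y ∧ f t ∈ Y := by
  obtain ⟨z, hz⟩ := Set.ncard_eq_one.1 hY
  have hA : A.ncard = 2 := by have := F.card; omega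
  obtain ⟨x, y, hxy, hAe⟩ := Set.ncard_eq_two.1 hA
  obtain ⟨i, hi⟩ := (F.memA x).1 (by simp [hAe])
  obtain ⟨j, hj⟩ := (F.memA y).1 (by simp [hAe])
  obtain ⟨k, hk⟩ := (F.memY z).1 (by simp [hz])
  have hij : i ≠ j := by rintro rfl; rw [hi] at hj; exact hxy (Sum.inl.inj hj)
  have hik : i ≠ k := by rintro rfl; rw [hi] at hk; simp at hk
  have hjk : j ≠ k := by rintro rfl; rw [hj] at hk; simp at hk
  have h1 := F.adj i j (hH i j hij)
  have h2 := F.adj i k (hH i k hik)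
  have h3 := F.adj j k (hH j k hjk)
  rw [hi, hj] at h1
  rw [hi, hk] at h2
  rw [hj, hk] at h3
  obtain ⟨s, hs, hs1, hs2⟩ := h2
  obtain ⟨t, ht, ht1, ht2⟩ := h3
  exact ⟨x, y, s, t, hAe, hxy, h1, hs, ht, hs2, ht2, by simp [hz, hs1], by simp [hz, ht1]⟩

lemma dpairs_finset {n : ℕ} (T : SimpleGraph (Fin n)) [DecidableRel T.Adj] (s : Finset (Fin n)) :
    dpairs T (s : Set (Fin n)) =
      ((s ×ˢ s).filter (fun p : Fin n × Fin n => T.Adj p.1 p.2)).card := by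
  unfold dpairs
  rw [← Set.ncard_coe_finset]
  congr 1
  ext p
  simp [and_assoc]

set_option maxRecDepth 4000 in
lemma c5_bound (Y : Set (Fin 5)) (hY : Y.Nonempty) :
    2 * dpairs (cycleGraph 5) Y + 5 ≤ 5 * Y.ncard ∧
    (2 * dpairs (cycleGraph 5) Y + 5 = 5 * Y.ncard → Y.ncard = 1 ∨ Y.ncard = 5) := by
  classical
  obtain ⟨s, rfl⟩ : ∃ s : Finset (Fin 5), (s : Set (Fin 5)) = Y := ⟨Y.toFinset, by simp⟩
  rw [dpairs_finset, Set.ncard_coe_finset]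
  have key : ∀ s : Finset (Fin 5), s.Nonempty →
      2 * ((s ×ˢ s).filter (fun p : Fin 5 × Fin 5 => (cycleGraph 5).Adj p.1 p.2)).card + 5
        ≤ 5 * s.card ∧
      (2 * ((s ×ˢ s).filter (fun p : Fin 5 × Fin 5 => (cycleGraph 5).Adj p.1 p.2)).card + 5
        = 5 * s.card → s.card = 1 ∨ s.card = 5) := by decide
  exact key s (by simpa using hY)

lemma ncard_le_card {V : Type} [Fintype V] (R : Set V) : R.ncard ≤ Fintype.card V := by
  rw [← Nat.card_eq_fintype_card, ← Set.ncard_univ]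
  exact Set.ncard_le_ncard (Set.subset_univ _)

lemma ncard_univ_card {V : Type} [Fintype V] : (Set.univ : Set V).ncard = Fintype.card V := by
  rw [Set.ncard_univ, Nat.card_eq_fintype_card]

lemma cex_pot {V : Type} [Fintype V] {G : SimpleGraph V} (hG : SmallestCex G) :
    (2 : ℤ) ≤ 5 * (Fintype.card V : ℤ) - 2 * (dpairs G Set.univ : ℤ) := by
  rw [← pot_eq]; exact hG.2.2.2.2.1

/-- Folding `R` onto the five-cycle. -/
lemma fold_c5 {V : Type} [Fintype V] {G : SimpleGraph V} (hG : SmallestCex G) (R : Set V)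
    (h6 : 6 ≤ R.ncard) (hR : R ≠ Set.univ) :
    ∃ (f : V → Fin 5) (m : ℕ) (H : SimpleGraph (Fin m)) (g : Fin m → V ⊕ Fin 5) (A : Set V)
      (Y : Set (Fin 5)), FoldData G (cycleGraph 5) R f m H g A Y ∧ m < Fintype.card V ∧
      A.Nonempty ∧ Y.Nonempty ∧ (R ∪ A).ncard = R.ncard + A.ncard := by
  obtain ⟨f, hf⟩ := crit_color hG.1 R hR
  obtain ⟨m, H, g, A, Y, F, hm⟩ := fold_exists hG.1 (cycleGraph 5) R f hf (by simp; omega)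
  refine ⟨f, m, H, g, A, Y, F, hm, fold_A_nonempty F id (fun s t h => h), ?_, ?_⟩
  · by_contra hY
    rw [Set.not_nonempty_iff_eq_empty] at hY
    have hne : R.Nonempty := by
      rw [← Set.ncard_pos]; omega
    obtain ⟨w, hw⟩ := hne
    refine fold_no_lift hG.1 F (fun _ => w) w hw ?_ ?_ ?_ <;> simp [hY]
  · rw [Set.ncard_union_eq]
    rw [Set.disjoint_right]
    exact F.disj

lemma potential_lemma {V : Type} [Fintype V] {G : SimpleGraph V} (hG : SmallestCex G) :
    ∀ (k : ℕ) (R : Set V), Fintype.card V - R.ncard = k → 6 ≤ R.ncard → R ≠ Set.univ →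
      (4 : ℤ) ≤ 5 * (R.ncard : ℤ) - 2 * (dpairs G R : ℤ) := by
  intro k
  induction k using Nat.strong_induction_on with
  | _ k ih =>
    intro R hk h6 hR
    obtain ⟨f, m, H, g, A, Y, F, hm, hA, hY, hRA⟩ := fold_c5 hG R h6 hR
    have h1 := dpairs_union G R f A Y
    have h2 := F.count
    have h3 := F.card
    have h4 := c5_bound Y hY
    have h5 := small_pot hG H F.crit hm
    have hApos : 0 < A.ncard := (Set.ncard_pos).2 hA
    by_cases hU : R ∪ A = Set.univ
    · have h7 := cex_pot hG
      rw [hU] at h1 hRA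
      rw [ncard_univ_card] at hRA
      rcases h5 with h5 | ⟨h5, -, -⟩ <;> omega
    · have hle := ncard_le_card (R ∪ A)
      have h7 := ih (Fintype.card V - (R ∪ A).ncard) (by omega) (R ∪ A) rfl (by omega) hU
      rcases h5 with h5 | ⟨h5, -, -⟩ <;> omega

/-- Extension of a coloring along an ear with three edges. -/
lemma c5_ear (a b : Fin 5) (h : a ≠ b) : ∃ x y : Fin 5, (cycleGraph 5).Adj x a ∧
    (cycleGraph 5).Adj x y ∧ (cycleGraph 5).Adj y b := by
  revert a b; decide

lemma pot_four {V : Type} [Fintype V] {G : SimpleGraph V} (hG : SmallestCex G) (R : Set V)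
    (h6 : 6 ≤ R.ncard) (hR : R ≠ Set.univ)
    (h4 : 5 * (R.ncard : ℤ) - 2 * (dpairs G R : ℤ) ≤ 4) :
    ∃ s ∈ R, ∃ t ∈ R, s ≠ t ∧ ∀ f : V → Fin 5,
      (∀ u ∈ R, ∀ v ∈ R, G.Adj u v → (cycleGraph 5).Adj (f u) (f v)) → f s = f t := by
  classical
  obtain ⟨f, m, H, g, A, Y, F, hm, hA, hY, hRA⟩ := fold_c5 hG R h6 hR
  have h1 := dpairs_union G R f A Y
  have h2 := F.count
  have h3 := F.card
  have hb := c5_bound Y hY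
  have h5 := small_pot hG H F.crit hm
  have hApos : 0 < A.ncard := (Set.ncard_pos).2 hA
  have hYpos : 0 < Y.ncard := (Set.ncard_pos).2 hY
  have hU : R ∪ A = Set.univ := by
    by_contra hU
    have h7 := potential_lemma hG _ (R ∪ A) rfl (by omega) hU
    rcases h5 with h5 | ⟨h5, -, -⟩ <;> omega
  have h7 := cex_pot hG
  rw [hU] at h1 hRA
  rw [ncard_univ_card] at hRA
  rcases h5 with h5 | ⟨h5, hm3, hH⟩
  · omega
  have hY1 : Y.ncard = 1 := by omega
  obtain ⟨x, y, s, t, hAe, hxy, axy, hs, ht, axs, ayt, -, -⟩ := fold_ear F hm3 hH hY1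
  have hxR : x ∉ R := F.disj x (by simp [hAe])
  have hyR : y ∉ R := F.disj y (by simp [hAe])
  have hA2 : A.ncard = 2 := by omega
  -- all pairs are accounted for
  have hsub : {p : V × V | p.1 ∈ R ∧ p.2 ∈ R ∧ G.Adj p.1 p.2} ∪
      (↑({(x,y),(y,x),(x,s),(s,x),(y,t),(t,y)} : Finset (V × V)) : Set (V × V)) ⊆
      {p : V × V | p.1 ∈ Set.univ ∧ p.2 ∈ Set.univ ∧ G.Adj p.1 p.2} := by
    rintro p (⟨_, _, hp⟩ | hp)
    · exact ⟨trivial, trivial, hp⟩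
    · simp only [Finset.coe_insert, Finset.coe_singleton, Set.mem_insert_iff,
        Set.mem_singleton_iff] at hp
      refine ⟨trivial, trivial, ?_⟩
      rcases hp with h|h|h|h|h|h <;> subst h
      exacts [axy, axy.symm, axs, axs.symm, ayt, ayt.symm]
  have hsx : s ≠ x := fun h => hxR (h ▸ hs)
  have hsy : s ≠ y := fun h => hyR (h ▸ hs)
  have htx : t ≠ x := fun h => hxR (h ▸ ht)
  have hty : t ≠ y := fun h => hyR (h ▸ ht)
  have hc : ({p : V × V | p.1 ∈ R ∧ p.2 ∈ R ∧ G.Adj p.1 p.2} ∪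
      (↑({(x,y),(y,x),(x,s),(s,x),(y,t),(t,y)} : Finset (V × V)) : Set (V × V))).ncard =
      dpairs G R + 6 := by
    rw [Set.ncard_union_eq, Set.ncard_coe_finset]
    · congr 1
      rw [Finset.card_insert_of_notMem, Finset.card_insert_of_notMem, Finset.card_insert_of_notMem,
        Finset.card_insert_of_notMem, Finset.card_insert_of_notMem, Finset.card_singleton] <;>
      simp [hxy, hxy.symm, hsx, hsy, hty, hsx.symm, hsy.symm, htx.symm, hty.symm]
    · rw [Set.disjoint_right]
      intro p hp hp2
      simp only [Finset.coe_insert, Finset.coe_singleton, Set.mem_insert_iff,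
        Set.mem_singleton_iff] at hp
      rcases hp with h|h|h|h|h|h <;> subst h
      exacts [hxR hp2.1, hyR hp2.1, hxR hp2.1, hxR hp2.2.1, hyR hp2.1, hyR hp2.2.1]
  have heq := Set.eq_of_subset_of_ncard_le hsub (by
    rw [hc]
    change dpairs G Set.univ ≤ _
    omega) (Set.toFinite _)
  have hall : ∀ u v, G.Adj u v → (u ∈ R ∧ v ∈ R) ∨ (u = x ∧ v = y) ∨ (u = y ∧ v = x) ∨
      (u = x ∧ v = s) ∨ (u = s ∧ v = x) ∨ (u = y ∧ v = t) ∨ (u = t ∧ v = y) := by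
    intro u v huv
    have : (u, v) ∈ {p : V × V | p.1 ∈ Set.univ ∧ p.2 ∈ Set.univ ∧ G.Adj p.1 p.2} :=
      ⟨trivial, trivial, huv⟩
    rw [← heq] at this
    rcases this with h | h
    · exact Or.inl ⟨h.1, h.2.1⟩
    · right
      simpa using h
  refine ⟨s, hs, t, ht, ?_, ?_⟩
  · rintro rfl
    exact triangle_free hG x y s axy ayt axs
  · intro c hc
    by_contra hne
    obtain ⟨cx, cy, e1, e2, e3⟩ := c5_ear _ _ hne
    have hx' : ∀ u ∈ R, u ≠ x := fun u hu h => hxR (h ▸ hu)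
    have hy' : ∀ u ∈ R, u ≠ y := fun u hu h => hyR (h ▸ hu)
    refine not_color hG.1 (fun v => if v = x then cx else if v = y then cy else c v) ?_
    intro u v huv
    rcases hall u v huv with ⟨h, h'⟩|⟨h, h'⟩|⟨h, h'⟩|⟨h, h'⟩|⟨h, h'⟩|⟨h, h'⟩|⟨h, h'⟩
    · simp only [hx' u h, hy' u h, hx' v h', hy' v h', if_false]
      exact hc u h v h' huv
    all_goals subst h; subst h'
    · simpa [hxy.symm] using e2
    · simpa [hxy.symm] using e2.symm
    · simpa [hsx, hsy] using e1
    · simpa [hsx, hsy] using e1.symm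
    · simpa [hxy.symm, htx, hty] using e3
    · simpa [hxy.symm, htx, hty] using e3.symm

/-- The ordered adjacent pairs of the theta graph with paths of lengths 2, 3, 4. -/
def thetaPairs : Finset (Fin 8 × Fin 8) :=
  {(0,1),(1,2),(2,3),(3,4),(4,5),(5,0),(0,6),(6,7),(7,2),
   (1,0),(2,1),(3,2),(4,3),(5,4),(0,5),(6,0),(7,6),(2,7)}

/-- Four colorings of the theta graph. -/
def thetaCol : Fin 4 → Fin 8 → Fin 5 :=
  ![![0,1,2,1,0,4,4,3], ![0,1,2,1,0,1,4,3], ![0,1,2,1,2,1,4,3], ![0,1,2,3,2,1,4,3]]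

lemma thetaCol_adj : ∀ k, ∀ p ∈ thetaPairs, (cycleGraph 5).Adj (thetaCol k p.1) (thetaCol k p.2) := by
  decide

lemma thetaCol_sep : ∀ i j, i ≠ j → ∃ k, thetaCol k i ≠ thetaCol k j := by
  decide

lemma theta_sep {V : Type} [Fintype V] {G : SimpleGraph V} (T : Fin 8 → V)
    (hT : Function.Injective T) (hadj : ∀ p ∈ thetaPairs, G.Adj (T p.1) (T p.2))
    (hD : dpairs G (Set.range T) ≤ 18) (s t : V) (hs : s ∈ Set.range T) (ht : t ∈ Set.range T)
    (hst : s ≠ t) :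
    ∃ f : V → Fin 5, (∀ u ∈ Set.range T, ∀ v ∈ Set.range T, G.Adj u v →
      (cycleGraph 5).Adj (f u) (f v)) ∧ f s ≠ f t := by
  classical
  have hinj : Function.Injective (Prod.map T T) := hT.prodMap hT
  have hsub : Prod.map T T '' (thetaPairs : Set (Fin 8 × Fin 8)) ⊆
      {p : V × V | p.1 ∈ Set.range T ∧ p.2 ∈ Set.range T ∧ G.Adj p.1 p.2} := by
    rintro _ ⟨p, hp, rfl⟩
    exact ⟨⟨_, rfl⟩, ⟨_, rfl⟩, hadj p hp⟩
  have heq := Set.eq_of_subset_of_ncard_le hsub (by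
    rw [Set.ncard_image_of_injective _ hinj, Set.ncard_coe_finset]
    exact hD) (Set.toFinite _)
  have hall : ∀ i j, G.Adj (T i) (T j) → (i, j) ∈ thetaPairs := by
    intro i j hij
    have : (T i, T j) ∈ {p : V × V | p.1 ∈ Set.range T ∧ p.2 ∈ Set.range T ∧ G.Adj p.1 p.2} :=
      ⟨⟨i, rfl⟩, ⟨j, rfl⟩, hij⟩
    rw [← heq] at this
    obtain ⟨p, hp, hpe⟩ := this
    have : p = (i, j) := hinj hpe
    rw [← this]; exact hp
  obtain ⟨i, rfl⟩ := hs
  obtain ⟨j, rfl⟩ := ht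
  obtain ⟨k, hk⟩ := thetaCol_sep i j (fun h => hst (by rw [h]))
  refine ⟨Function.extend T (thetaCol k) (fun _ => 0), ?_, ?_⟩
  · rintro _ ⟨a, rfl⟩ _ ⟨b, rfl⟩ hab
    rw [hT.extend_apply, hT.extend_apply]
    exact thetaCol_adj k _ (hall a b hab)
  · rwa [hT.extend_apply, hT.extend_apply]

/-- `c` traces a six-cycle in `G`. -/
def Cyc6 {V : Type} (G : SimpleGraph V) (c : Fin 6 → V) : Prop :=
  Function.Injective c ∧ ∀ i, G.Adj (c i) (c (i + 1))

lemma Cyc6.rot {V : Type} {G : SimpleGraph V} {c : Fin 6 → V} (hc : Cyc6 G c) (i : Fin 6) :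
    Cyc6 G (fun k => c (i + k)) :=
  ⟨fun a b h => add_left_cancel (hc.1 h), fun k => by
    have := hc.2 (i + k)
    rwa [add_assoc] at this⟩

lemma rot_range {V : Type} (c : Fin 6 → V) (i : Fin 6) :
    Set.range (fun k => c (i + k)) = Set.range c :=
  (Equiv.addLeft i).surjective.range_comp c

lemma theta_contra0 {V : Type} [Fintype V] {G : SimpleGraph V} (hG : SmallestCex G)
    (c : Fin 6 → V) (hc : Cyc6 G c) (x y : V) (hx : x ∉ Set.range c) (hy : y ∉ Set.range c)
    (hxy : G.Adj x y) (h0 : G.Adj x (c 0)) (h2 : G.Adj y (c 2))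
    (hne : Set.range c ∪ {x, y} ≠ Set.univ)
    (h4 : 5 * ((Set.range c ∪ {x, y}).ncard : ℤ) - 2 * (dpairs G (Set.range c ∪ {x, y}) : ℤ) ≤ 4) :
    False := by
  classical
  let T : Fin 8 → V := ![c 0, c 1, c 2, c 3, c 4, c 5, x, y]
  have hxc : ∀ i, c i ≠ x := fun i h => hx ⟨i, h⟩
  have hyc : ∀ i, c i ≠ y := fun i h => hy ⟨i, h⟩
  have hTi : Function.Injective T := by
    intro i j hij
    fin_cases i <;> fin_cases j <;>
      simp [T, hc.1.eq_iff, hxc, hyc, (hxc _).symm, (hyc _).symm, hxy.ne, hxy.ne.symm] at hij ⊢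
  have hr : Set.range T = Set.range c ∪ {x, y} := by
    ext v
    simp only [Set.mem_range, Set.mem_union, Set.mem_insert_iff, Set.mem_singleton_iff]
    constructor
    · rintro ⟨i, rfl⟩
      fin_cases i
      · exact Or.inl ⟨0, rfl⟩
      · exact Or.inl ⟨1, rfl⟩
      · exact Or.inl ⟨2, rfl⟩
      · exact Or.inl ⟨3, rfl⟩
      · exact Or.inl ⟨4, rfl⟩
      · exact Or.inl ⟨5, rfl⟩
      · exact Or.inr (Or.inl rfl)
      · exact Or.inr (Or.inr rfl)
    · rintro (⟨i, rfl⟩ | rfl | rfl)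
      · fin_cases i
        · exact ⟨0, rfl⟩
        · exact ⟨1, rfl⟩
        · exact ⟨2, rfl⟩
        · exact ⟨3, rfl⟩
        · exact ⟨4, rfl⟩
        · exact ⟨5, rfl⟩
      · exact ⟨6, rfl⟩
      · exact ⟨7, rfl⟩
  have hcard : (Set.range T).ncard = 8 := by
    rw [← Set.image_univ, Set.ncard_image_of_injective _ hTi, Set.ncard_univ]; simp
  rw [← hr] at hne h4
  have hp := potential_lemma hG _ _ rfl (by omega) hne
  obtain ⟨s, hs, t, ht, hst, hcol⟩ := pot_four hG _ (by omega) hne h4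
  have hadj : ∀ p ∈ thetaPairs, G.Adj (T p.1) (T p.2) := by
    intro p hp
    simp only [thetaPairs, Finset.mem_insert, Finset.mem_singleton] at hp
    rcases hp with h|h|h|h|h|h|h|h|h|h|h|h|h|h|h|h|h|h <;> subst h
    exacts [hc.2 0, hc.2 1, hc.2 2, hc.2 3, hc.2 4, hc.2 5, h0.symm, hxy, h2,
      (hc.2 0).symm, (hc.2 1).symm, (hc.2 2).symm, (hc.2 3).symm, (hc.2 4).symm, (hc.2 5).symm,
      h0, hxy.symm, h2.symm]
  obtain ⟨f, hf, hfst⟩ := theta_sep T hTi hadj (by omega) s t hs ht hst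
  exact hfst (hcol f hf)

lemma theta_contra {V : Type} [Fintype V] {G : SimpleGraph V} (hG : SmallestCex G)
    (c : Fin 6 → V) (hc : Cyc6 G c) (i : Fin 6) (x y : V) (hx : x ∉ Set.range c)
    (hy : y ∉ Set.range c)
    (hxy : G.Adj x y) (h0 : G.Adj x (c i)) (h2 : G.Adj y (c (i + 2)))
    (hne : Set.range c ∪ {x, y} ≠ Set.univ)
    (h4 : 5 * ((Set.range c ∪ {x, y}).ncard : ℤ) - 2 * (dpairs G (Set.range c ∪ {x, y}) : ℤ) ≤ 4) :
    False := by
  rw [← rot_range c i] at hx hy hne h4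
  exact theta_contra0 hG _ (hc.rot i) x y hx hy hxy (by simpa using h0) h2 hne h4

/-- The star with three leaves. -/
def star3 : SimpleGraph (Fin 4) where
  Adj a b := a ≠ b ∧ (a = 0 ∨ b = 0)
  symm := ⟨fun _ _ h => ⟨h.1.symm, h.2.symm⟩⟩
  loopless := ⟨fun _ h => h.1 rfl⟩

instance : DecidableRel star3.Adj := fun a b =>
  inferInstanceAs (Decidable (a ≠ b ∧ (a = 0 ∨ b = 0)))

lemma star3_bound (Y : Set (Fin 4)) (hY : 0 ∈ Y) : 2 * dpairs star3 Y + 4 ≤ 4 * Y.ncard := by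
  classical
  obtain ⟨s, rfl⟩ : ∃ s : Finset (Fin 4), (s : Set (Fin 4)) = Y := ⟨Y.toFinset, by simp⟩
  rw [dpairs_finset, Set.ncard_coe_finset]
  have key : ∀ s : Finset (Fin 4), 0 ∈ s →
      2 * ((s ×ˢ s).filter (fun p : Fin 4 × Fin 4 => star3.Adj p.1 p.2)).card + 4
        ≤ 4 * s.card := by decide
  exact key s (by simpa using hY)

/-- The folding of the six-cycle to the star. -/
def sfold : Fin 6 → Fin 4 := ![0, 1, 0, 2, 0, 3]

/-- Adjacent index pairs of the six-cycle. -/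
def cycPairs : Finset (Fin 6 × Fin 6) :=
  Finset.univ.filter (fun p => p.2 = p.1 + 1 ∨ p.1 = p.2 + 1)

lemma cycPairs_card : cycPairs.card = 12 := by decide

lemma cyc_adj {V : Type} [Fintype V] {G : SimpleGraph V} (hG : SmallestCex G)
    {c : Fin 6 → V} (hc : Cyc6 G c) (i j : Fin 6) (h : G.Adj (c i) (c j)) :
    star3.Adj (sfold i) (sfold j) := by
  have key : ∀ i j : Fin 6, star3.Adj (sfold i) (sfold j) ∨ j = i ∨ j = i + 1 + 1 ∨
    i = j + 1 + 1 := by decide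
  rcases key i j with h1 | h1 | h1 | h1
  · exact h1
  · subst h1; exact absurd h G.irrefl
  · subst h1; exact (triangle_free hG _ _ _ (hc.2 i) (hc.2 (i + 1)) h).elim
  · subst h1; exact (triangle_free hG _ _ _ (hc.2 j) (hc.2 (j + 1)) h.symm).elim

lemma star_lemma {V : Type} [Fintype V] {G : SimpleGraph V} (hG : SmallestCex G)
    (c : Fin 6 → V) (hc : Cyc6 G c) :
    ∃ i : Fin 6, (i = 1 ∨ i = 3 ∨ i = 5) ∧ ∀ j : Fin 6, (j = 1 ∨ j = 3 ∨ j = 5) → j ≠ i →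
      ∀ w, G.Adj (c j) w → w = c (j + 1) ∨ w = c (j - 1) := by
  classical
  let f : V → Fin 4 := Function.extend c sfold (fun _ => 0)
  have hfc : ∀ i, f (c i) = sfold i := fun i => hc.1.extend_apply _ _ i
  let R := Set.range c
  have hRc : R.ncard = 6 := by
    simp only [R]
    rw [← Set.image_univ, Set.ncard_image_of_injective _ hc.1, Set.ncard_univ]; simp
  obtain ⟨m, H, g, A, Y, F, hm⟩ := fold_exists hG.1 star3 R f (by
    rintro _ ⟨i, rfl⟩ _ ⟨j, rfl⟩ h
    rw [hfc, hfc]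
    exact cyc_adj hG hc i j h) (by rw [hRc]; simp)
  have hA : A.Nonempty := fold_A_nonempty F ![0, 1, 1, 1] (by decide)
  have h0 : 0 ∈ Y := by
    by_contra h0
    refine fold_no_lift hG.1 F ![c 0, c 1, c 3, c 5] (c 0) ⟨0, rfl⟩ ?_ ?_ ?_
    · intro s hs
      have hs0 : s ≠ 0 := fun h => h0 (h ▸ hs)
      fin_cases s
      · exact absurd rfl hs0
      all_goals simp [hc.1.eq_iff]
    · rintro s hs _ ⟨i, rfl⟩ hi
      rw [hfc] at hi
      have hs0 : s ≠ 0 := fun h => h0 (h ▸ hs)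
      have key : ∀ i : Fin 6, ∀ s : Fin 4, sfold i = s → s ≠ 0 →
        i = (![0, 1, 3, 5] : Fin 4 → Fin 6) s := by decide
      have h1 := key i s hi hs0
      rw [h1]
      fin_cases s <;> rfl
    · intro s hs t ht hst
      rcases hst.2 with h | h
      · exact absurd (h ▸ hs) h0
      · exact absurd (h ▸ ht) h0
  have h1 := dpairs_union G R f A Y
  have h2 := F.count
  have h3 := F.card
  have hb := star3_bound Y h0
  have h5 := small_pot hG H F.crit hm
  have hApos : 0 < A.ncard := (Set.ncard_pos).2 hA
  have hYpos : 0 < Y.ncard := (Set.ncard_pos).2 ⟨0, h0⟩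
  have hRA : (R ∪ A).ncard = R.ncard + A.ncard := by
    rw [Set.ncard_union_eq]
    rw [Set.disjoint_right]
    exact F.disj
  let P1 : Set (V × V) := Prod.map c c '' (cycPairs : Set (Fin 6 × Fin 6))
  have hP1 : P1.ncard = 12 := by
    simp only [P1]
    rw [Set.ncard_image_of_injective _ (hc.1.prodMap hc.1), Set.ncard_coe_finset, cycPairs_card]
  have hP1adj : ∀ p ∈ P1, p.1 ∈ R ∧ p.2 ∈ R ∧ G.Adj p.1 p.2 := by
    rintro _ ⟨⟨i, j⟩, hp, rfl⟩
    refine ⟨⟨i, rfl⟩, ⟨j, rfl⟩, ?_⟩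
    simp only [cycPairs, Finset.coe_filter, Finset.mem_univ, true_and] at hp
    rcases hp with h | h
    · simp only at h; subst h; exact hc.2 i
    · simp only at h; subst h; exact (hc.2 j).symm
  have hDR : 12 ≤ dpairs G R := by
    rw [← hP1]
    exact Set.ncard_le_ncard hP1adj (Set.toFinite _)
  have hU : R ∪ A = Set.univ := by
    by_contra hU
    have hp := potential_lemma hG _ (R ∪ A) rfl (by omega) hU
    rcases h5 with h5 | ⟨h5, hm3, hH⟩
    · omega
    have hY1 : Y.ncard = 1 := by omega
    have hD : 18 ≤ dpairs G (R ∪ A) := by omega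
    have hle : 5 * ((R ∪ A).ncard : ℤ) - 2 * (dpairs G (R ∪ A) : ℤ) ≤ 4 := by omega
    obtain ⟨x, y, s, t, hAe, hxy, axy, hs, ht, axs, ayt, hsY, htY⟩ := fold_ear F hm3 hH hY1
    have hxR : x ∉ R := F.disj x (by simp [hAe])
    have hyR : y ∉ R := F.disj y (by simp [hAe])
    obtain ⟨z, hz⟩ := Set.ncard_eq_one.1 hY1
    obtain ⟨i, rfl⟩ := hs
    obtain ⟨j, rfl⟩ := ht
    rw [hfc] at hsY htY
    rw [hz, Set.mem_singleton_iff] at h0 hsY htY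
    subst h0
    have key : ∀ i j : Fin 6, sfold i = 0 → sfold j = 0 → i = j ∨ j = i + 2 ∨ i = j + 2 := by
      decide
    rw [hAe] at hU hle
    rcases key i j hsY htY with h | h | h
    · subst h
      exact triangle_free hG _ _ _ axy ayt axs
    · subst h
      exact theta_contra hG c hc i x y hxR hyR axy axs ayt hU hle
    · subst h
      rw [Set.pair_comm] at hU hle
      exact theta_contra hG c hc j y x hyR hxR axy.symm ayt axs hU hle
  have h7 := cex_pot hG
  rw [hU] at h1 hRA
  rw [ncard_univ_card] at hRA
  have hY2 : Y.ncard ≤ 2 := by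
    rcases h5 with h5 | ⟨h5, hm3, hH⟩ <;> omega
  have hYu : ∀ s ∈ Y, ∀ t ∈ Y, s ≠ 0 → t ≠ 0 → s = t := by
    intro s hs t ht hs0 ht0
    by_contra hst
    have hsub : ({0, s, t} : Set (Fin 4)) ⊆ Y := by
      rintro u (rfl | rfl | rfl) <;> assumption
    have := Set.ncard_le_ncard hsub
    rw [Set.ncard_eq_three.2 ⟨0, s, t, hs0.symm, ht0.symm, hst, rfl⟩] at this
    omega
  have main : ∀ j, sfold j ∉ Y → ∀ w, G.Adj (c j) w → w = c (j + 1) ∨ w = c (j - 1) := by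
    intro j hj w hw
    by_contra hcon
    push Not at hcon
    have hjA : c j ∉ A := fun h => F.disj _ h ⟨j, rfl⟩
    have hjY : f (c j) ∉ Y := by rwa [hfc]
    have d1 : Disjoint P1 (usedPairs G R f A Y) := by
      rw [Set.disjoint_left]
      intro p hp hp2
      have := hP1adj p hp
      exact hp2.2.1 ⟨this.1, this.2.1⟩
    have d2 : Disjoint (P1 ∪ usedPairs G R f A Y) {(c j, w), (w, c j)} := by
      rw [Set.disjoint_right]
      rintro p hp (hp1 | hp2)
      · obtain ⟨⟨a, b⟩, hab, hpe⟩ := hp1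
        simp only [cycPairs, Finset.coe_filter, Finset.mem_univ, true_and] at hab
        have hab' : b = a + 1 ∨ a = b + 1 := hab
        rcases hp with rfl | rfl
        · simp only [Prod.map_apply, Prod.mk.injEq] at hpe
          have := hc.1 hpe.1
          subst this
          rcases hab' with h | h
          · exact hcon.1 (by rw [← h, hpe.2])
          · exact hcon.2 (by rw [h, ← hpe.2]; simp)
        · simp only [Prod.map_apply, Prod.mk.injEq] at hpe
          have := hc.1 hpe.2
          subst this
          rcases hab' with h | h
          · exact hcon.2 (by rw [h, ← hpe.1]; simp)
          · exact hcon.1 (by rw [← h, hpe.1])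
      · rcases hp with rfl | rfl
        · rcases hp2.2.2.1 with h | h
          · exact hjA h
          · exact hjY h.2
        · rcases hp2.2.2.2 with h | h
          · exact hjA h
          · exact hjY h.2
    have hsub : (P1 ∪ usedPairs G R f A Y) ∪ {(c j, w), (w, c j)} ⊆
        {p : V × V | p.1 ∈ Set.univ ∧ p.2 ∈ Set.univ ∧ G.Adj p.1 p.2} := by
      rintro p ((hp | hp) | hp)
      · exact ⟨trivial, trivial, (hP1adj p hp).2.2⟩
      · exact ⟨trivial, trivial, hp.1⟩
      · rcases hp with rfl | rfl
        · exact ⟨trivial, trivial, hw⟩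
        · exact ⟨trivial, trivial, hw.symm⟩
    have hn := Set.ncard_le_ncard hsub (Set.toFinite _)
    rw [Set.ncard_union_eq d2, Set.ncard_union_eq d1, Set.ncard_pair (by
      simp only [ne_eq, Prod.mk.injEq, not_and]; intro h; exact absurd h hw.ne), hP1] at hn
    change _ ≤ dpairs G Set.univ at hn
    rcases h5 with h5 | ⟨h5, hm3, hH⟩ <;> omega
  by_cases y1 : (1 : Fin 4) ∈ Y
  · refine ⟨1, by simp, ?_⟩
    rintro j hj hne
    apply main
    intro hY'
    rcases hj with rfl | rfl | rfl
    · exact hne rfl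
    · exact absurd (hYu _ y1 _ hY' (by decide) (by decide)) (by decide)
    · exact absurd (hYu _ y1 _ hY' (by decide) (by decide)) (by decide)
  by_cases y2 : (2 : Fin 4) ∈ Y
  · refine ⟨3, by simp, ?_⟩
    rintro j hj hne
    apply main
    intro hY'
    rcases hj with rfl | rfl | rfl
    · exact y1 hY'
    · exact hne rfl
    · exact absurd (hYu _ y2 _ hY' (by decide) (by decide)) (by decide)
  · refine ⟨5, by simp, ?_⟩
    rintro j hj hne
    apply main
    intro hY'
    rcases hj with rfl | rfl | rfl
    · exact y1 hY'
    · exact y2 hY'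
    · exact hne rfl

lemma final_contra {V : Type} [Fintype V] {G : SimpleGraph V} (hG : SmallestCex G)
    (c : Fin 6 → V) (hc : Cyc6 G c) (h0 : ∀ w, G.Adj (c 0) w → w = c 1 ∨ w = c 5)
    (h1 : ∀ w, G.Adj (c 1) w → w = c 2 ∨ w = c 0) : False := by
  classical
  obtain ⟨h, hh⟩ := crit_color hG.1 {v | v ≠ c 0 ∧ v ≠ c 1} (by
    intro h
    have : c 0 ∈ {v | v ≠ c 0 ∧ v ≠ c 1} := by rw [h]; trivial
    exact this.1 rfl)
  let ρ : V → V := fun v => if v = c 0 then c 4 else if v = c 1 then c 3 else v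
  have e0 : ρ (c 0) = c 4 := by simp [ρ]
  have e1 : ρ (c 1) = c 3 := by simp [ρ, hc.1.eq_iff]
  have e : ∀ v, v ≠ c 0 → v ≠ c 1 → ρ v = v := by intro v ha hb; simp [ρ, ha, hb]
  have e2 : ρ (c 2) = c 2 := e _ (by simp [hc.1.eq_iff]) (by simp [hc.1.eq_iff])
  have e5 : ρ (c 5) = c 5 := e _ (by simp [hc.1.eq_iff]) (by simp [hc.1.eq_iff])
  have a0 : ∀ w, G.Adj (c 0) w → G.Adj (ρ (c 0)) (ρ w) := by
    intro w hw
    rcases h0 w hw with rfl | rfl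
    · rw [e0, e1]; exact (hc.2 3).symm
    · rw [e0, e5]; exact hc.2 4
  have a1 : ∀ w, G.Adj (c 1) w → G.Adj (ρ (c 1)) (ρ w) := by
    intro w hw
    rcases h1 w hw with rfl | rfl
    · rw [e1, e2]; exact (hc.2 2).symm
    · rw [e0, e1]; exact hc.2 3
  have hρ : ∀ v, ρ v ≠ c 0 ∧ ρ v ≠ c 1 := by
    intro v
    by_cases hv0 : v = c 0
    · rw [hv0, e0]; simp [hc.1.eq_iff]
    by_cases hv1 : v = c 1
    · rw [hv1, e1]; simp [hc.1.eq_iff]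
    rw [e v hv0 hv1]; exact ⟨hv0, hv1⟩
  refine not_color hG.1 (fun v => h (ρ v)) ?_
  intro u v huv
  refine hh _ (hρ u) _ (hρ v) ?_
  by_cases hu0 : u = c 0
  · subst hu0; exact a0 v huv
  by_cases hu1 : u = c 1
  · subst hu1; exact a1 v huv
  by_cases hv0 : v = c 0
  · subst hv0; exact (a0 u huv.symm).symm
  by_cases hv1 : v = c 1
  · subst hv1; exact (a1 u huv.symm).symm
  rw [e u hu0 hu1, e v hv0 hv1]; exact huv

lemma no_cyc6 {V : Type} [Fintype V] {G : SimpleGraph V} (hG : SmallestCex G)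
    (c : Fin 6 → V) (hc : Cyc6 G c) : False := by
  obtain ⟨i, hi, H1⟩ := star_lemma hG c hc
  obtain ⟨k, hk, H2⟩ := star_lemma hG _ (hc.rot 1)
  have good : ∀ b, b ≠ i → b ≠ 1 + k → ∀ w, G.Adj (c b) w → w = c (b + 1) ∨ w = c (b - 1) := by
    intro b hbi hbk w hw
    have key : ∀ b : Fin 6, (b = 1 ∨ b = 3 ∨ b = 5) ∨ (b - 1 = 1 ∨ b - 1 = 3 ∨ b - 1 = 5) := by
      decide
    rcases key b with h | h
    · exact H1 b h hbi w hw
    · have h3 := H2 (b - 1) h (fun h' => hbk (by rw [← h']; simp)) w (by simpa using hw)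
      have r1 : 1 + (b - 1 + 1) = b + 1 := by clear * -; revert b; decide
      have r2 : 1 + (b - 1 - 1) = b - 1 := by clear * -; revert b; decide
      rw [r1, r2] at h3
      exact h3
  have key : ∀ i k : Fin 6, (i = 1 ∨ i = 3 ∨ i = 5) → (k = 1 ∨ k = 3 ∨ k = 5) →
    ∃ a : Fin 6, a ≠ i ∧ a ≠ 1 + k ∧ a + 1 ≠ i ∧ a + 1 ≠ 1 + k := by decide
  obtain ⟨a, p1, p2, p3, p4⟩ := key i k hi hk
  refine final_contra hG _ (hc.rot a) ?_ ?_
  · intro w hw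
    have := good a p1 p2 w (by simpa using hw)
    have r : a - 1 = a + 5 := by clear * -; revert a; decide
    rw [r] at this
    exact this
  · intro w hw
    have := good (a + 1) p3 p4 w hw
    have r : a + 1 + 1 = a + 2 := by clear * -; revert a; decide
    rw [r] at this
    simpa using this

lemma walk_cyc6 {V : Type} {G : SimpleGraph V} {v : V} (w : G.Walk v v) (hw : w.IsCycle)
    (hl : w.length = 6) : Cyc6 G (fun i : Fin 6 => w.getVert i) := by
  constructor
  · intro i j hij
    have := hw.getVert_injOn' (by simp [hl]; omega) (by simp [hl]; omega) hij
    exact Fin.ext this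
  · intro i
    have h := w.adj_getVert_succ (i := i) (by omega)
    fin_cases i
    · exact h
    · exact h
    · exact h
    · exact h
    · exact h
    · have h6 : w.getVert 6 = v := by rw [← hl]; exact w.getVert_length
      have h0 : w.getVert 0 = v := w.getVert_zero
      change G.Adj (w.getVert 5) (w.getVert 6) at h
      change G.Adj (w.getVert 5) (w.getVert 0)
      rw [h0]; rw [h6] at h; exact h

/-- A smallest counterexample contains no cycle of length 6. -/
theorem smallestCex_no_six_cycle {V : Type} [Fintype V] (G : SimpleGraph V)
    (h : SmallestCex G) :
    ∀ (v : V) (c : G.Walk v v), c.IsCycle → c.length ≠ 6 := by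
  intro v c hc hl
  exact no_cyc6 h _ (walk_cyc6 c hc hl)
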